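/- arXiv:hep-th/0503086 — 11 statements merged into one kernel-verified Lean document; each statement's English description precedes it below -/
import Mathlib

section
/- For every integer n ≥ 1, the total volume of the equivariant moduli space equals π²; concretely, 2π ∫₀^∞ χ F_n(χ) dχ = π², where F_n(χ) = 2π ∫₀^∞ r^{2n+1} / ((1+r²)² (1+χ² r^{2n})²) dr. -/
open MeasureTheory Real Set

lemma hasDerivAt_neg_inv_two_mul_one_add_mul_sq {a : ℝ} (ha : 0 < a) (x : ℝ) :
    HasDerivAt (fun x : ℝ => -(2 * (1 + a * x ^ 2))⁻¹) (x * a / (1 + a * x ^ 2) ^ 2) x := by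
  have hx : 2 * (1 + a * x ^ 2) ≠ 0 := by positivity
  have h : HasDerivAt (fun x : ℝ => 2 * (1 + a * x ^ 2)) (2 * (a * (2 * x))) x := by
    simpa using (((hasDerivAt_pow 2 x).const_mul a).const_add 1).const_mul 2
  refine (h.fun_inv hx).fun_neg.congr_deriv ?_
  field_simp

lemma tendsto_neg_inv_two_mul_one_add_mul_sq {a : ℝ} (ha : 0 < a) :
    Filter.Tendsto (fun x : ℝ => -(2 * (1 + a * x ^ 2))⁻¹) Filter.atTop (nhds 0) := by
  have h : Filter.Tendsto (fun x : ℝ => 2 * (1 + a * x ^ 2)) Filter.atTop Filter.atTop :=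
    (Filter.tendsto_atTop_add_const_left _ 1
      ((Filter.tendsto_pow_atTop two_ne_zero).const_mul_atTop ha)).const_mul_atTop two_pos
  simpa using h.inv_tendsto_atTop.neg

lemma integrableOn_mul_div_one_add_mul_sq_sq {a : ℝ} (ha : 0 < a) :
    IntegrableOn (fun x : ℝ => x * a / (1 + a * x ^ 2) ^ 2) (Ioi 0) :=
  integrableOn_Ioi_deriv_of_nonneg'
    (fun x _ => hasDerivAt_neg_inv_two_mul_one_add_mul_sq ha x)
    (fun x hx => by have : 0 < x := hx; positivity)
    (tendsto_neg_inv_two_mul_one_add_mul_sq ha)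

lemma integral_Ioi_mul_div_one_add_mul_sq_sq {a : ℝ} (ha : 0 < a) :
    ∫ x in Ioi (0 : ℝ), x * a / (1 + a * x ^ 2) ^ 2 = 1 / 2 := by
  rw [integral_Ioi_of_hasDerivAt_of_nonneg'
    (fun x _ => hasDerivAt_neg_inv_two_mul_one_add_mul_sq ha x)
    (fun x hx => by have : 0 < x := hx; positivity)
    (tendsto_neg_inv_two_mul_one_add_mul_sq ha)]
  norm_num

/-- For every integer `n ≥ 1`, the total volume of the equivariant moduli space equals `π²`:
`2π ∫₀^∞ χ Fₙ(χ) dχ = π²`, where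
`Fₙ(χ) = 2π ∫₀^∞ r^(2n+1) / ((1+r²)² (1+χ² r^(2n))²) dr`. -/
theorem volume_req_eq_pi_sq (n : ℕ) (hn : 1 ≤ n) :
    (2 * π) * (∫ χ in Ioi (0:ℝ), χ *
      (2 * π * ∫ r in Ioi (0:ℝ),
        r ^ (2*n+1) / ((1 + r^2)^2 * (1 + χ^2 * r^(2*n))^2))) = π^2 := by
  set f : ℝ → ℝ → ℝ := fun r χ =>
    r * 1 / (1 + 1 * r ^ 2) ^ 2 * (χ * r ^ (2 * n) / (1 + r ^ (2 * n) * χ ^ 2) ^ 2) with hf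
  have hf_integral : ∀ r ∈ Ioi (0 : ℝ),
      ∫ χ in Ioi (0 : ℝ), f r χ = r * 1 / (1 + 1 * r ^ 2) ^ 2 * (1 / 2) := fun r hr => by
    rw [hf, integral_const_mul, integral_Ioi_mul_div_one_add_mul_sq_sq (pow_pos hr _)]
  have hf_int : Integrable (Function.uncurry f)
      ((volume.restrict (Ioi 0)).prod (volume.restrict (Ioi 0))) := by
    rw [integrable_prod_iff (by
      apply Measurable.aestronglyMeasurable
      simp only [hf, Function.uncurry_def]
      fun_prop)]
    refine ⟨?_, ?_⟩
    · filter_upwards [ae_restrict_mem measurableSet_Ioi] with r hr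
      exact (integrableOn_mul_div_one_add_mul_sq_sq (pow_pos hr (2 * n))).const_mul
        (r * 1 / (1 + 1 * r ^ 2) ^ 2)
    · refine ((integrableOn_mul_div_one_add_mul_sq_sq one_pos).mul_const (1 / 2)).congr ?_
      filter_upwards [ae_restrict_mem measurableSet_Ioi] with r hr
      rw [← hf_integral r hr]
      refine setIntegral_congr_fun measurableSet_Ioi fun χ hχ => ?_
      have hr' : 0 < r := hr
      have hχ' : 0 < χ := hχ
      exact (Real.norm_of_nonneg (by simp only [hf]; positivity)).symm
  have hF : ∀ χ : ℝ, χ * (2 * π * ∫ r in Ioi (0:ℝ),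
      r ^ (2*n+1) / ((1 + r^2)^2 * (1 + χ^2 * r^(2*n))^2)) =
        2 * π * ∫ r in Ioi (0 : ℝ), f r χ := fun χ => by
    rw [mul_left_comm, ← integral_const_mul]
    congr 2 with r
    simp only [hf, one_mul, mul_one, pow_succ r (2 * n), mul_comm (χ ^ 2)]
    rw [div_mul_div_comm, mul_div_assoc']
    ring
  simp_rw [hF]
  rw [integral_const_mul, ← integral_integral_swap hf_int,
    setIntegral_congr_fun measurableSet_Ioi hf_integral, integral_mul_const,
    integral_Ioi_mul_div_one_add_mul_sq_sq one_pos]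
  ring
end

section
/- For every integer n ≥ 1 and every real χ > 0, F_n(1/χ) = χ⁴ F_n(χ), where F_n(χ) = 2π ∫₀^∞ r^{2n+1} / ((1+r²)² (1+χ² r^{2n})²) dr. -/
open MeasureTheory Real Set

/-- For every integer `n ≥ 1` and every real `χ > 0`, `Fₙ(1/χ) = χ⁴ Fₙ(χ)`, where
`Fₙ(χ) = 2π ∫₀^∞ r^(2n+1) / ((1+r²)² (1+χ² r^(2n))²) dr`. -/
theorem F_inv_eq (n : ℕ) (hn : 1 ≤ n) (F : ℝ → ℝ)
    (hF : ∀ χ : ℝ, F χ = 2 * π * ∫ r in Ioi (0:ℝ),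
      r ^ (2*n+1) / ((1 + r^2)^2 * (1 + χ^2 * r^(2*n))^2))
    (χ : ℝ) (hχ : 0 < χ) :
    F (1/χ) = χ^4 * F χ := by
  rw [hF, hF, ← integral_comp_rpow_Ioi _ (neg_ne_zero.mpr (one_ne_zero (α := ℝ))),
    mul_left_comm, ← integral_const_mul (χ ^ 4)]
  congr 1
  refine setIntegral_congr_fun measurableSet_Ioi fun r hr => ?_
  have hr : 0 < r := hr
  have h2 : r ^ ((-1 : ℝ) - 1) = (r ^ 2)⁻¹ := by
    rw [show (-1 : ℝ) - 1 = -((2 : ℕ) : ℝ) by norm_num, rpow_neg hr.le, rpow_natCast]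
  simp only [h2, rpow_neg_one, abs_neg, abs_one, one_mul, smul_eq_mul, inv_pow, one_div,
    pow_succ r (2 * n)]
  have ha : 0 < r ^ (2 * n) := pow_pos hr _
  generalize r ^ (2 * n) = a at ha ⊢
  field_simp
  ring
end

section
/- For every integer n ≥ 2, the limit as ρ → 0⁺ of F̃_n(ρ) = π n² ∫₀^∞ s^n / ((ρ²+s)² (1+s^n)²) ds exists and equals π n² ∫₀^∞ s^{n-2} / (1+s^n)² ds, and this value is finite and strictly positive. -/
open MeasureTheory Real Set Filter Topology

lemma pow_div_one_add_pow_sq_le (m : ℕ) {s : ℝ} (hs : 0 < s) :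
    s ^ m / (1 + s ^ (m + 2)) ^ 2 ≤ 2 * (1 + s ^ 2)⁻¹ := by
  have hm : 0 < s ^ m := pow_pos hs m
  have hn : 0 < s ^ (m + 2) := pow_pos hs _
  rw [← div_eq_mul_inv, div_le_div_iff₀ (by positivity) (by positivity)]
  have key : s ^ m ≤ 1 + s ^ (m + 2) := by
    rcases le_total s 1 with h | h
    · linarith [pow_le_one₀ (n := m) hs.le h]
    · linarith [pow_le_pow_right₀ h (Nat.le_add_right m 2)]
  have hexp : s ^ m * (1 + s ^ 2) = s ^ m + s ^ (m + 2) := by ring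
  rw [hexp]
  nlinarith

lemma integrableOn_pow_div_one_add_pow_sq (m : ℕ) :
    IntegrableOn (fun s : ℝ => s ^ m / (1 + s ^ (m + 2)) ^ 2) (Ioi (0 : ℝ)) := by
  refine Integrable.mono' (integrable_inv_one_add_sq.const_mul 2).integrableOn
    (Measurable.aestronglyMeasurable (by fun_prop)) ?_
  filter_upwards [ae_restrict_mem measurableSet_Ioi] with s hs
  have hs : 0 < s := hs
  rw [Real.norm_of_nonneg (by positivity)]
  exact pow_div_one_add_pow_sq_le m hs

/-- For every integer `n ≥ 2`, `F̃ₙ(ρ) = π n² ∫₀^∞ sⁿ / ((ρ²+s)² (1+sⁿ)²) ds` tends, as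
`ρ → 0⁺`, to `π n² ∫₀^∞ s^(n-2) / (1+sⁿ)² ds`, which is finite and strictly positive. -/
theorem Ftilde_limit_at_zero (n : ℕ) (hn : 2 ≤ n) :
    IntegrableOn (fun s : ℝ => s ^ (n-2) / (1 + s^n)^2) (Ioi (0:ℝ)) ∧
    0 < π * (n:ℝ)^2 * ∫ s in Ioi (0:ℝ), s ^ (n-2) / (1 + s^n)^2 ∧
    Tendsto (fun ρ : ℝ => π * (n:ℝ)^2 * ∫ s in Ioi (0:ℝ),
        s ^ n / ((ρ^2 + s)^2 * (1 + s^n)^2))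
      (𝓝[>] 0)
      (𝓝 (π * (n:ℝ)^2 * ∫ s in Ioi (0:ℝ), s ^ (n-2) / (1 + s^n)^2)) := by
  obtain ⟨m, rfl⟩ := Nat.exists_eq_add_of_le' hn
  rw [Nat.add_sub_cancel]
  have hint := integrableOn_pow_div_one_add_pow_sq m
  refine ⟨hint, ?_, Tendsto.const_mul _ ?_⟩
  · refine mul_pos (by positivity) ?_
    rw [setIntegral_pos_iff_support_of_nonneg_ae _ hint]
    · have hsub : Ioi (0 : ℝ) ⊆
          Function.support (fun s : ℝ => s ^ m / (1 + s ^ (m + 2)) ^ 2) ∩ Ioi 0 := by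
        intro s hs
        have hs' : 0 < s := hs
        exact ⟨ne_of_gt (by positivity), hs⟩
      exact lt_of_lt_of_le (by simp) (measure_mono hsub)
    · filter_upwards [ae_restrict_mem measurableSet_Ioi] with s hs
      have hs : 0 < s := hs
      simp only [Pi.zero_apply]
      positivity
  · refine tendsto_integral_filter_of_dominated_convergence _
      (Eventually.of_forall fun ρ => Measurable.aestronglyMeasurable (by fun_prop)) ?_ hint ?_
    · refine Eventually.of_forall fun ρ => ?_
      filter_upwards [ae_restrict_mem measurableSet_Ioi] with s hs
      have hs : 0 < s := hs
      rw [Real.norm_of_nonneg (by positivity), div_le_div_iff₀ (by positivity) (by positivity)]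
      have hsq : s ^ 2 ≤ (ρ ^ 2 + s) ^ 2 :=
        pow_le_pow_left₀ hs.le (by nlinarith [sq_nonneg ρ]) 2
      calc s ^ (m + 2) * (1 + s ^ (m + 2)) ^ 2
          = s ^ m * (s ^ 2 * (1 + s ^ (m + 2)) ^ 2) := by ring
        _ ≤ s ^ m * ((ρ ^ 2 + s) ^ 2 * (1 + s ^ (m + 2)) ^ 2) := by gcongr
    · filter_upwards [ae_restrict_mem measurableSet_Ioi] with s hs
      have hs : 0 < s := hs
      have hcont : ContinuousAt
          (fun ρ : ℝ => s ^ (m + 2) / ((ρ ^ 2 + s) ^ 2 * (1 + s ^ (m + 2)) ^ 2)) 0 := by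
        refine ContinuousAt.div (by fun_prop) (by fun_prop) (ne_of_gt (by positivity))
      have hval : s ^ m / (1 + s ^ (m + 2)) ^ 2 =
          s ^ (m + 2) / (((0 : ℝ) ^ 2 + s) ^ 2 * (1 + s ^ (m + 2)) ^ 2) := by
        rw [div_eq_div_iff (by positivity) (by positivity)]
        ring
      rw [hval]
      exact hcont.tendsto.mono_left nhdsWithin_le_nhds
end

section
/- For every integer n ≥ 3, the limit as ρ → 0⁺ of f_n(ρ) = ∫₀^∞ s^n / ((ρ²+s)³ (1+s^n)²) ds exists and equals ∫₀^∞ s^{n-3} / (1+s^n)² ds, which is finite. -/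
open MeasureTheory Real Set Filter Topology

lemma pow_le_one_add_pow {k n : ℕ} (hkn : k ≤ n) {s : ℝ} (hs : 0 ≤ s) : s ^ k ≤ 1 + s ^ n := by
  rcases le_total s 1 with h | h
  · linarith [pow_le_one₀ hs h (n := k), pow_nonneg hs n]
  · linarith [pow_le_pow_right₀ h hkn]

lemma integrableOn_pow_sub_three_div (n : ℕ) (hn : 3 ≤ n) :
    IntegrableOn (fun s : ℝ => s ^ (n - 3) / (1 + s ^ n) ^ 2) (Ioi (0 : ℝ)) := by
  refine ((integrable_inv_one_add_sq.const_mul 2).integrableOn (s := Ioi (0 : ℝ))).mono'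
    (Measurable.aestronglyMeasurable (by fun_prop)) ?_
  filter_upwards [ae_restrict_mem measurableSet_Ioi] with s hs
  have hs : 0 < s := hs
  rw [norm_of_nonneg (by positivity), ← div_eq_mul_inv, div_le_div_iff₀ (by positivity)
    (by positivity)]
  have h₁ : s ^ (n - 3) ≤ 1 + s ^ n := pow_le_one_add_pow (by omega) hs.le
  have h₂ : s ^ (n - 3) * s ^ 2 ≤ 1 + s ^ n := by
    rw [← pow_add]
    exact pow_le_one_add_pow (by omega) hs.le
  nlinarith [pow_pos hs n]

lemma pow_div_cube_mul {n : ℕ} (hn : 3 ≤ n) {s : ℝ} (hs : s ≠ 0) (a : ℝ) :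
    s ^ n / (s ^ 3 * a) = s ^ (n - 3) / a := by
  rw [← pow_sub_mul_pow s hn, mul_comm (s ^ (n - 3)),
    mul_div_mul_left _ _ (pow_ne_zero 3 hs)]

/-- For every integer `n ≥ 3`, `fₙ(ρ) = ∫₀^∞ sⁿ / ((ρ²+s)³ (1+sⁿ)²) ds` tends, as
`ρ → 0⁺`, to `∫₀^∞ s^(n-3) / (1+sⁿ)² ds`, which is finite. -/
theorem f_limit_at_zero (n : ℕ) (hn : 3 ≤ n) :
    IntegrableOn (fun s : ℝ => s ^ (n-3) / (1 + s^n)^2) (Ioi (0:ℝ)) ∧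
    Tendsto (fun ρ : ℝ => ∫ s in Ioi (0:ℝ), s ^ n / ((ρ^2 + s)^3 * (1 + s^n)^2))
      (𝓝[>] 0) (𝓝 (∫ s in Ioi (0:ℝ), s ^ (n-3) / (1 + s^n)^2)) := by
  have hint := integrableOn_pow_sub_three_div n hn
  refine ⟨hint, tendsto_integral_filter_of_dominated_convergence _
    (.of_forall fun ρ => Measurable.aestronglyMeasurable (by fun_prop))
    (.of_forall fun ρ => ?_) hint ?_⟩
  · filter_upwards [ae_restrict_mem measurableSet_Ioi] with s hs
    have hs : 0 < s := hs
    rw [norm_of_nonneg (by positivity), ← pow_div_cube_mul hn hs.ne']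
    gcongr
    linarith [sq_nonneg ρ]
  · filter_upwards [ae_restrict_mem measurableSet_Ioi] with s hs
    have hs : 0 < s := hs
    have hcont : ContinuousAt (fun ρ : ℝ => s ^ n / ((ρ ^ 2 + s) ^ 3 * (1 + s ^ n) ^ 2)) 0 :=
      ContinuousAt.div (by fun_prop) (by fun_prop) (by positivity)
    have hlim := hcont.tendsto
    rw [zero_pow two_ne_zero, zero_add, pow_div_cube_mul hn hs.ne'] at hlim
    exact hlim.mono_left nhdsWithin_le_nhds
end

section
/- For every integer n ≥ 4, lim_{ρ→0⁺} (F̃_n''(ρ) - F̃_n'(ρ)/ρ) = 0, where F̃_n(ρ) = π n² ∫₀^∞ s^n / ((ρ²+s)² (1+s^n)²) ds; consequently (together with lim_{ρ→0⁺} F̃_n'(ρ) = 0) the lifted metric F̃_n(ρ)(dρ² + ρ² dλ²) extends to a C² metric on S². -/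
open MeasureTheory Real Set Filter Topology

lemma integrand_le_inv_one_add_sq {n k : ℕ} (hn : 2 ≤ n) (hk : k ≤ n) (ρ : ℝ) {s : ℝ}
    (hs : 0 < s) :
    s ^ n / ((ρ ^ 2 + s) ^ k * (1 + s ^ n) ^ 2) ≤ 2 * (1 + s ^ 2)⁻¹ := by
  have hpow : ∀ m ≤ n, s ^ m ≤ 1 + s ^ n := by
    intro m hm
    rcases le_total s 1 with h | h
    · have h₁ : s ^ m ≤ 1 := pow_le_one₀ hs.le h
      have h₂ : 0 < s ^ n := by positivity
      linarith
    · have := pow_le_pow_right₀ h hm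
      linarith
  have hnum : s ^ n ≤ (ρ ^ 2 + s) ^ k * (1 + s ^ n) := by
    calc s ^ n = s ^ k * s ^ (n - k) := by rw [← pow_add, Nat.add_sub_cancel' hk]
      _ ≤ (ρ ^ 2 + s) ^ k * (1 + s ^ n) := by
        gcongr
        · linarith [sq_nonneg ρ]
        · exact hpow _ (Nat.sub_le n k)
  have hsq : 1 + s ^ 2 ≤ 2 * (1 + s ^ n) := by
    have h₁ := hpow 2 hn
    have h₂ : 0 < s ^ n := by positivity
    linarith
  rw [← div_eq_mul_inv, div_le_div_iff₀ (by positivity) (by positivity)]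
  calc s ^ n * (1 + s ^ 2) ≤ ((ρ ^ 2 + s) ^ k * (1 + s ^ n)) * (2 * (1 + s ^ n)) := by gcongr
    _ = 2 * ((ρ ^ 2 + s) ^ k * (1 + s ^ n) ^ 2) := by ring

lemma integrableOn_two_mul_inv_one_add_sq :
    IntegrableOn (fun s : ℝ => 2 * (1 + s ^ 2)⁻¹) (Ioi 0) :=
  (integrable_inv_one_add_sq.const_mul 2).integrableOn

lemma integrableOn_integrand {n k : ℕ} (hn : 2 ≤ n) (hk : k ≤ n) (ρ : ℝ) :
    IntegrableOn (fun s : ℝ => s ^ n / ((ρ ^ 2 + s) ^ k * (1 + s ^ n) ^ 2)) (Ioi 0) := by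
  refine integrableOn_two_mul_inv_one_add_sq.mono'
    (Measurable.aestronglyMeasurable (by fun_prop)) ?_
  filter_upwards [ae_restrict_mem measurableSet_Ioi] with s hs
  have hs : 0 < s := hs
  rw [Real.norm_of_nonneg (by positivity)]
  exact integrand_le_inv_one_add_sq hn hk ρ hs

lemma hasDerivAt_integral_integrand {n k : ℕ} (hn : 2 ≤ n) (hk : k + 1 ≤ n) (ρ : ℝ) :
    HasDerivAt (fun r : ℝ => ∫ s in Ioi (0:ℝ), s ^ n / ((r ^ 2 + s) ^ k * (1 + s ^ n) ^ 2))
      (-2 * k * ρ * ∫ s in Ioi (0:ℝ), s ^ n / ((ρ ^ 2 + s) ^ (k + 1) * (1 + s ^ n) ^ 2)) ρ := by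
  rw [← integral_const_mul]
  refine (hasDerivAt_integral_of_dominated_loc_of_deriv_le
    (F := fun r s => s ^ n / ((r ^ 2 + s) ^ k * (1 + s ^ n) ^ 2))
    (μ := volume.restrict (Ioi 0))
    (F' := fun r s => -2 * k * r * (s ^ n / ((r ^ 2 + s) ^ (k + 1) * (1 + s ^ n) ^ 2)))
    (bound := fun s => 2 * k * (|ρ| + 1) * (2 * (1 + s ^ 2)⁻¹))
    (Metric.ball_mem_nhds ρ one_pos) ?_ (integrableOn_integrand hn (by lia) ρ) ?_ ?_ ?_ ?_).2
  · exact Eventually.of_forall fun r => Measurable.aestronglyMeasurable (by fun_prop)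
  · exact Measurable.aestronglyMeasurable (by fun_prop)
  · filter_upwards [ae_restrict_mem measurableSet_Ioi] with s hs r hr
    have hs : 0 < s := hs
    have hr : |r| ≤ |ρ| + 1 := by
      rw [Metric.mem_ball, Real.dist_eq] at hr
      linarith [abs_sub_abs_le_abs_sub r ρ]
    rw [norm_mul, Real.norm_of_nonneg (r := _ / _) (by positivity)]
    have h : ‖-2 * (k:ℝ) * r‖ = 2 * k * |r| := by simp
    rw [h]
    gcongr
    exact integrand_le_inv_one_add_sq hn hk r hs
  · exact integrableOn_two_mul_inv_one_add_sq.const_mul _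
  · filter_upwards [ae_restrict_mem measurableSet_Ioi] with s hs r _
    have hs : 0 < s := hs
    have hpos : 0 < r ^ 2 + s := by positivity
    have hd : HasDerivAt (fun r : ℝ => (r ^ 2 + s) ^ k * (1 + s ^ n) ^ 2)
        (k * (r ^ 2 + s) ^ (k - 1) * (2 * r) * (1 + s ^ n) ^ 2) r := by
      have h := (((hasDerivAt_pow 2 r).add_const s).pow k).mul_const ((1 + s ^ n) ^ 2)
      simpa using h
    refine ((hasDerivAt_const r (s ^ n)).div hd (by positivity)).congr_deriv ?_
    rcases k with _ | k
    · simp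
    · rw [Nat.add_sub_cancel]
      field_simp
      ring

/-- For every integer `n ≥ 4`, `lim_{ρ→0⁺} (F̃ₙ''(ρ) - F̃ₙ'(ρ)/ρ) = 0`, where
`F̃ₙ(ρ) = π n² ∫₀^∞ sⁿ / ((ρ²+s)² (1+sⁿ)²) ds`. -/
theorem Ftilde_second_deriv_limit (n : ℕ) (hn : 4 ≤ n) (F : ℝ → ℝ)
    (hF : ∀ ρ : ℝ, F ρ = π * (n:ℝ)^2 * ∫ s in Ioi (0:ℝ),
      s ^ n / ((ρ^2 + s)^2 * (1 + s^n)^2)) :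
    Tendsto (fun ρ : ℝ => deriv (deriv F) ρ - deriv F ρ / ρ) (𝓝[>] 0) (𝓝 0) := by
  set G : ℕ → ℝ → ℝ := fun k ρ =>
    ∫ s in Ioi (0:ℝ), s ^ n / ((ρ ^ 2 + s) ^ k * (1 + s ^ n) ^ 2) with hG
  have hGd : ∀ k, k + 1 ≤ n → ∀ ρ, HasDerivAt (G k) (-2 * k * ρ * G (k + 1) ρ) ρ :=
    fun k hk ρ => hasDerivAt_integral_integrand (by lia) hk ρ
  have hF₀ : F = fun ρ => π * (n:ℝ) ^ 2 * G 2 ρ := funext hF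
  have hF₁ : deriv F = fun ρ => π * (n:ℝ) ^ 2 * (-4 * ρ * G 3 ρ) := by
    funext ρ
    rw [hF₀, ((hGd 2 (by lia) ρ).const_mul _).deriv]
    norm_num
  have hF₂ : ∀ ρ, deriv (deriv F) ρ =
      π * (n:ℝ) ^ 2 * (-4 * G 3 ρ + 24 * ρ ^ 2 * G 4 ρ) := by
    intro ρ
    rw [hF₁]
    have h := ((((hasDerivAt_id ρ).const_mul (-4)).mul (hGd 3 (by lia) ρ)).const_mul
      (π * (n:ℝ) ^ 2))
    refine (h.congr_deriv ?_).deriv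
    simp only [id]
    push_cast
    ring
  have hbound : ∀ ρ, |G 4 ρ| ≤ ∫ s in Ioi (0:ℝ), 2 * (1 + s ^ 2)⁻¹ := by
    intro ρ
    rw [abs_of_nonneg (setIntegral_nonneg measurableSet_Ioi fun s (hs : 0 < s) => by positivity)]
    exact setIntegral_mono_on (integrableOn_integrand (by lia) hn ρ)
      integrableOn_two_mul_inv_one_add_sq measurableSet_Ioi
      fun s hs => integrand_le_inv_one_add_sq (by lia) hn ρ hs
  have hlim : Tendsto (fun ρ : ℝ => 24 * π * (n:ℝ) ^ 2 * ρ ^ 2) (𝓝[>] 0) (𝓝 0) := by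
    have h : Continuous fun ρ : ℝ => 24 * π * (n:ℝ) ^ 2 * ρ ^ 2 := by fun_prop
    exact (h.tendsto' 0 0 (by simp)).mono_left nhdsWithin_le_nhds
  have hprod : Tendsto (fun ρ : ℝ => 24 * π * (n:ℝ) ^ 2 * ρ ^ 2 * G 4 ρ) (𝓝[>] 0) (𝓝 0) :=
    hlim.zero_mul_isBoundedUnder_le (isBoundedUnder_of ⟨_, hbound⟩)
  refine hprod.congr' ?_
  filter_upwards [self_mem_nhdsWithin] with ρ hρ
  have hρ : ρ ≠ 0 := ne_of_gt hρ
  rw [hF₂, hF₁]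
  field_simp
  ring
end

section
/- For every integer n ≥ 4, lim_{ρ→0⁺} f_n'(ρ) = 0, where f_n(ρ) = ∫₀^∞ s^n / ((ρ²+s)³ (1+s^n)²) ds; explicitly, f_n'(ρ) = -6ρ ∫₀^∞ s^n / ((ρ²+s)⁴ (1+s^n)²) ds and this tends to 0 as ρ → 0⁺. -/
open MeasureTheory Real Set Filter Topology

lemma pow_div_mul_one_add_pow_sq_le {n k : ℕ} (hk : 2 ≤ k) (hkn : k ≤ n) {c s : ℝ}
    (hc : 0 ≤ c) (hs : 0 < s) :
    s ^ n / ((c + s) ^ k * (1 + s ^ n) ^ 2) ≤ 2 * (1 + s ^ 2)⁻¹ := by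
  obtain ⟨m, rfl⟩ := Nat.exists_eq_add_of_le hkn
  have hpos : 0 < s ^ (k + m) := pow_pos hs _
  have key : s ^ m * (1 + s ^ 2) ≤ 2 * (1 + s ^ (k + m)) ^ 2 := by
    rcases le_total s 1 with h | h
    · have h1 : s ^ m ≤ 1 := pow_le_one₀ hs.le h
      have h2 : s ^ 2 ≤ 1 := pow_le_one₀ hs.le h
      have h3 : s ^ m * (1 + s ^ 2) ≤ 1 * 2 := by gcongr; linarith
      nlinarith
    · have h1 : s ^ m ≤ s ^ (k + m) := pow_le_pow_right₀ h (by omega)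
      have h2 : s ^ (m + 2) ≤ s ^ (k + m) := pow_le_pow_right₀ h (by omega)
      rw [pow_add] at h2
      nlinarith
  rw [← div_eq_mul_inv, div_le_div_iff₀ (by positivity) (by positivity)]
  calc s ^ (k + m) * (1 + s ^ 2) = s ^ k * (s ^ m * (1 + s ^ 2)) := by ring
    _ ≤ (c + s) ^ k * (2 * (1 + s ^ (k + m)) ^ 2) := by gcongr; linarith
    _ = 2 * ((c + s) ^ k * (1 + s ^ (k + m)) ^ 2) := by ring

lemma norm_pow_div_mul_one_add_pow_sq_le {n k : ℕ} (hk : 2 ≤ k) (hkn : k ≤ n) {c s : ℝ}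
    (hc : 0 ≤ c) (hs : 0 < s) :
    ‖s ^ n / ((c + s) ^ k * (1 + s ^ n) ^ 2)‖ ≤ 2 * (1 + s ^ 2)⁻¹ := by
  rw [Real.norm_of_nonneg (by positivity)]
  exact pow_div_mul_one_add_pow_sq_le hk hkn hc hs

lemma integrableOn_pow_div_mul_one_add_pow_sq {n k : ℕ} (hk : 2 ≤ k) (hkn : k ≤ n) {c : ℝ}
    (hc : 0 ≤ c) :
    IntegrableOn (fun s : ℝ => s ^ n / ((c + s) ^ k * (1 + s ^ n) ^ 2)) (Ioi 0) := by
  refine (integrable_inv_one_add_sq.const_mul 2).integrableOn.mono'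
    (Measurable.aestronglyMeasurable (by fun_prop)) ?_
  filter_upwards [ae_restrict_mem measurableSet_Ioi] with s hs
  exact norm_pow_div_mul_one_add_pow_sq_le hk hkn hc hs

/-- For every integer `n ≥ 4`, `lim_{ρ→0⁺} fₙ'(ρ) = 0`, where
`fₙ(ρ) = ∫₀^∞ sⁿ / ((ρ²+s)³ (1+sⁿ)²) ds`; explicitly
`fₙ'(ρ) = -6ρ ∫₀^∞ sⁿ / ((ρ²+s)⁴ (1+sⁿ)²) ds` and this tends to `0` as `ρ → 0⁺`. -/
theorem f_deriv_limit_zero (n : ℕ) (hn : 4 ≤ n) (f : ℝ → ℝ)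
    (hf : ∀ ρ : ℝ, f ρ = ∫ s in Ioi (0:ℝ), s ^ n / ((ρ^2 + s)^3 * (1 + s^n)^2)) :
    (∀ ρ : ℝ, 0 < ρ → HasDerivAt f
      (-6 * ρ * ∫ s in Ioi (0:ℝ), s ^ n / ((ρ^2 + s)^4 * (1 + s^n)^2)) ρ) ∧
    Tendsto (fun ρ : ℝ =>
        -6 * ρ * ∫ s in Ioi (0:ℝ), s ^ n / ((ρ^2 + s)^4 * (1 + s^n)^2))
      (𝓝[>] 0) (𝓝 0) ∧
    Tendsto (fun ρ : ℝ => deriv f ρ) (𝓝[>] 0) (𝓝 0) := by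
  have hderiv : ∀ ρ : ℝ, 0 < ρ → HasDerivAt f
      (-6 * ρ * ∫ s in Ioi (0:ℝ), s ^ n / ((ρ^2 + s)^4 * (1 + s^n)^2)) ρ := by
    intro ρ hρ
    rw [funext hf, ← integral_const_mul]
    refine (hasDerivAt_integral_of_dominated_loc_of_deriv_le
      (F := fun ρ s : ℝ => s ^ n / ((ρ ^ 2 + s) ^ 3 * (1 + s ^ n) ^ 2))
      (F' := fun ρ s : ℝ => -6 * ρ * (s ^ n / ((ρ ^ 2 + s) ^ 4 * (1 + s ^ n) ^ 2)))
      (bound := fun s => 6 * (ρ + 1) * (2 * (1 + s ^ 2)⁻¹))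
      (Metric.ball_mem_nhds ρ one_pos) ?_ ?_ ?_ ?_ ?_ ?_).2
    · exact .of_forall fun x => Measurable.aestronglyMeasurable (by fun_prop)
    · exact integrableOn_pow_div_mul_one_add_pow_sq (by norm_num) (by omega) (sq_nonneg ρ)
    · exact Measurable.aestronglyMeasurable (by fun_prop)
    · filter_upwards [ae_restrict_mem measurableSet_Ioi] with s hs x hx
      rw [norm_mul]
      refine mul_le_mul ?_ (norm_pow_div_mul_one_add_pow_sq_le (by norm_num) hn (sq_nonneg x) hs)
        (norm_nonneg _) (by positivity)
      rw [Metric.mem_ball, Real.dist_eq, abs_lt] at hx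
      rw [Real.norm_eq_abs, abs_le]
      constructor <;> linarith
    · exact ((integrable_inv_one_add_sq.const_mul 2).const_mul _).integrableOn
    · filter_upwards [ae_restrict_mem measurableSet_Ioi] with s hs x _
      have hs : 0 < s := hs
      have hx : 0 < x ^ 2 + s := by positivity
      have hd : HasDerivAt (fun x : ℝ => (x ^ 2 + s) ^ 3 * (1 + s ^ n) ^ 2)
          ((3 * (x ^ 2 + s) ^ 2 * (2 * x)) * (1 + s ^ n) ^ 2) x := by
        simpa using (((hasDerivAt_pow 2 x).add_const s).pow 3).mul_const ((1 + s ^ n) ^ 2)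
      have h1 : 0 < 1 + s ^ n := by positivity
      refine ((hasDerivAt_const x (s ^ n)).div hd (by positivity)).congr_deriv ?_
      field_simp
      ring
  have hlim : Tendsto (fun ρ : ℝ =>
      -6 * ρ * ∫ s in Ioi (0:ℝ), s ^ n / ((ρ^2 + s)^4 * (1 + s^n)^2)) (𝓝[>] 0) (𝓝 0) := by
    set C := ∫ s in Ioi (0:ℝ), 2 * (1 + s ^ 2)⁻¹
    refine squeeze_zero_norm (a := fun ρ => ‖-6 * ρ‖ * C) (fun ρ => ?_) ?_
    · rw [norm_mul]
      gcongr
      refine norm_integral_le_of_norm_le (integrable_inv_one_add_sq.const_mul 2).integrableOn ?_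
      filter_upwards [ae_restrict_mem measurableSet_Ioi] with s hs
      exact norm_pow_div_mul_one_add_pow_sq_le (by norm_num) hn (sq_nonneg ρ) hs
    · have hc : Continuous fun ρ : ℝ => ‖-6 * ρ‖ * C := by fun_prop
      simpa using (hc.tendsto 0).mono_left nhdsWithin_le_nhds
  refine ⟨hderiv, hlim, hlim.congr' ?_⟩
  filter_upwards [self_mem_nhdsWithin] with ρ hρ
  exact (hderiv ρ hρ).deriv.symm
end

section
/- For every integer n ≥ 1 and every real ρ > 0, F̃_n(1/ρ) = ρ⁴ F̃_n(ρ), where F̃_n(ρ) = π n² ∫₀^∞ s^n / ((ρ²+s)² (1+s^n)²) ds. -/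
open MeasureTheory Real Set

/-- The change of variables `x ↦ x⁻¹` on the positive half-line. -/
theorem integral_Ioi_inv_sq_mul_comp_inv (g : ℝ → ℝ) :
    ∫ x in Ioi (0:ℝ), (x^2)⁻¹ * g x⁻¹ = ∫ y in Ioi (0:ℝ), g y := by
  rw [← integral_comp_rpow_Ioi g (p := -1) (by norm_num)]
  refine setIntegral_congr_fun measurableSet_Ioi fun x hx => ?_
  have h : x ^ ((-1:ℝ) - 1) = (x^2)⁻¹ := by
    rw [show (-1:ℝ) - 1 = -(2:ℕ) by norm_num, rpow_neg (mem_Ioi.mp hx).le, rpow_natCast]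
  simp [h, rpow_neg_one]

/-- For every integer `n ≥ 1` and every real `ρ > 0`, `F̃ₙ(1/ρ) = ρ⁴ F̃ₙ(ρ)`, where
`F̃ₙ(ρ) = π n² ∫₀^∞ sⁿ / ((ρ²+s)² (1+sⁿ)²) ds`. -/
theorem Ftilde_inv_eq (n : ℕ) (hn : 1 ≤ n) (F : ℝ → ℝ)
    (hF : ∀ ρ : ℝ, F ρ = π * (n:ℝ)^2 * ∫ s in Ioi (0:ℝ),
      s ^ n / ((ρ^2 + s)^2 * (1 + s^n)^2))
    (ρ : ℝ) (hρ : 0 < ρ) :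
    F (1/ρ) = ρ^4 * F ρ := by
  rw [hF, hF, mul_left_comm, ← integral_Ioi_inv_sq_mul_comp_inv,
    ← integral_const_mul (ρ^4)]
  congr 1
  refine setIntegral_congr_fun measurableSet_Ioi fun x hx => ?_
  have hx0 : 0 < x := hx
  have hxn : 0 < x ^ n := pow_pos hx0 n
  have h₁ : (1/ρ)^2 + x⁻¹ = (ρ^2 + x) / (ρ^2 * x) := by
    field_simp
    ring
  have h₂ : 1 + (x^n)⁻¹ = (1 + x^n) / x^n := by
    field_simp
    ring
  have h₃ : ρ^2 + x ≠ 0 := by positivity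
  have h₄ : 1 + x^n ≠ 0 := by positivity
  simp only [h₁, h₂, inv_pow]
  generalize x ^ n = y at *
  field_simp
end

section
/- For every integer n ≥ 2, lim_{ρ→0⁺} ρ F̃_n'(ρ) / (2 F̃_n(ρ)) = 0, where F̃_n(ρ) = π n² ∫₀^∞ s^n / ((ρ²+s)² (1+s^n)²) ds and F̃_n' is its derivative. -/
open MeasureTheory Real Set Filter Topology

lemma lumpIntegrand_le {n : ℕ} (hn : 2 ≤ n) (ρ : ℝ) {s : ℝ} (hs : 0 < s) :
    s ^ n / ((ρ ^ 2 + s) ^ 2 * (1 + s ^ n) ^ 2) ≤ (1 + s ^ 2)⁻¹ := by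
  obtain ⟨m, rfl⟩ := Nat.exists_eq_add_of_le hn
  have hm : s ^ m ≤ 1 + s ^ (2 + m) := by
    rcases le_total s 1 with h | h
    · have := pow_le_one₀ (n := m) hs.le h
      have : 0 < s ^ (2 + m) := by positivity
      linarith
    · have := pow_le_pow_right₀ h (Nat.le_add_left m 2)
      linarith
  have hsq : s ^ 2 ≤ (ρ ^ 2 + s) ^ 2 := by
    gcongr
    nlinarith [sq_nonneg ρ]
  rw [inv_eq_one_div, div_le_div_iff₀ (by positivity) (by positivity), one_mul]
  calc s ^ (2 + m) * (1 + s ^ 2) = s ^ 2 * (s ^ m + s ^ (2 + m)) := by ring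
    _ ≤ s ^ 2 * (1 + s ^ (2 + m)) ^ 2 := by
      gcongr
      nlinarith [sq_nonneg (s ^ (2 + m))]
    _ ≤ _ := by gcongr

lemma sq_mul_lumpDerivIntegrand_le {n : ℕ} (hn : 2 ≤ n) (ρ : ℝ) {s : ℝ} (hs : 0 < s) :
    ρ ^ 2 * (s ^ n / ((ρ ^ 2 + s) ^ 3 * (1 + s ^ n) ^ 2)) ≤ (1 + s ^ 2)⁻¹ := by
  have hpos : 0 < ρ ^ 2 + s := by positivity
  refine le_trans ?_ (lumpIntegrand_le hn ρ hs)
  calc ρ ^ 2 * (s ^ n / ((ρ ^ 2 + s) ^ 3 * (1 + s ^ n) ^ 2))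
      = ρ ^ 2 / (ρ ^ 2 + s) * (s ^ n / ((ρ ^ 2 + s) ^ 2 * (1 + s ^ n) ^ 2)) := by field_simp
    _ ≤ 1 * (s ^ n / ((ρ ^ 2 + s) ^ 2 * (1 + s ^ n) ^ 2)) := by
      gcongr
      rw [div_le_one hpos]
      linarith
    _ = _ := one_mul _

lemma integrableOn_lumpIntegrand {n : ℕ} (hn : 2 ≤ n) (ρ : ℝ) :
    IntegrableOn (fun s : ℝ => s ^ n / ((ρ ^ 2 + s) ^ 2 * (1 + s ^ n) ^ 2)) (Ioi 0) := by
  refine integrable_inv_one_add_sq.integrableOn.mono'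
    (Measurable.aestronglyMeasurable (by fun_prop)) ?_
  filter_upwards [ae_restrict_mem measurableSet_Ioi] with s hs
  have hs : 0 < s := hs
  rw [Real.norm_of_nonneg (by positivity)]
  exact lumpIntegrand_le hn ρ hs

lemma hasDerivAt_integral_lumpIntegrand {n : ℕ} (hn : 2 ≤ n) {ρ : ℝ} (hρ : 0 < ρ) :
    HasDerivAt (fun x : ℝ => ∫ s in Ioi (0:ℝ), s ^ n / ((x ^ 2 + s) ^ 2 * (1 + s ^ n) ^ 2))
      (∫ s in Ioi (0:ℝ), -4 * ρ * (s ^ n / ((ρ ^ 2 + s) ^ 3 * (1 + s ^ n) ^ 2))) ρ := by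
  refine (hasDerivAt_integral_of_dominated_loc_of_deriv_le
    (F := fun x s => s ^ n / ((x ^ 2 + s) ^ 2 * (1 + s ^ n) ^ 2))
    (F' := fun x s => -4 * x * (s ^ n / ((x ^ 2 + s) ^ 3 * (1 + s ^ n) ^ 2)))
    (bound := fun s => 8 / ρ * (1 + s ^ 2)⁻¹)
    (Ioi_mem_nhds (half_lt_self hρ)) (.of_forall fun x => Measurable.aestronglyMeasurable (by fun_prop))
    (integrableOn_lumpIntegrand hn ρ) (Measurable.aestronglyMeasurable (by fun_prop)) ?_
    (integrable_inv_one_add_sq.integrableOn.const_mul _) ?_).2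
  · filter_upwards [ae_restrict_mem measurableSet_Ioi] with s hs x hx
    have hs : 0 < s := hs
    have hx : ρ / 2 < x := hx
    have hx0 : 0 < x := by linarith
    rw [norm_mul, norm_mul, Real.norm_of_nonneg hx0.le, norm_neg, Real.norm_of_nonneg (by norm_num),
      Real.norm_of_nonneg (by positivity)]
    calc 4 * x * (s ^ n / ((x ^ 2 + s) ^ 3 * (1 + s ^ n) ^ 2))
        = 4 / x * (x ^ 2 * (s ^ n / ((x ^ 2 + s) ^ 3 * (1 + s ^ n) ^ 2))) := by field_simp
      _ ≤ 8 / ρ * (1 + s ^ 2)⁻¹ := by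
        gcongr ?_ * ?_
        · rw [div_le_div_iff₀ hx0 hρ]
          linarith
        · exact sq_mul_lumpDerivIntegrand_le hn x hs
  · filter_upwards [ae_restrict_mem measurableSet_Ioi] with s hs x _
    have hs : 0 < s := hs
    have hpos : 0 < x ^ 2 + s := by positivity
    have hden : HasDerivAt (fun x : ℝ => (x ^ 2 + s) ^ 2 * (1 + s ^ n) ^ 2)
        (2 * (x ^ 2 + s) * (2 * x) * (1 + s ^ n) ^ 2) x := by
      simpa using ((((hasDerivAt_id x).pow 2).add_const s).pow 2).mul_const ((1 + s ^ n) ^ 2)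
    refine ((hasDerivAt_const x (s ^ n)).fun_div hden (by positivity)).congr_deriv ?_
    field_simp
    ring

lemma tendsto_integral_lumpIntegrand {n : ℕ} (hn : 2 ≤ n) :
    Tendsto (fun ρ : ℝ => ∫ s in Ioi (0:ℝ), s ^ n / ((ρ ^ 2 + s) ^ 2 * (1 + s ^ n) ^ 2)) (𝓝[>] 0)
      (𝓝 (∫ s in Ioi (0:ℝ), s ^ n / (((0:ℝ) ^ 2 + s) ^ 2 * (1 + s ^ n) ^ 2))) := by
  refine tendsto_integral_filter_of_dominated_convergence (fun s => (1 + s ^ 2)⁻¹)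
    (.of_forall fun ρ => Measurable.aestronglyMeasurable (by fun_prop))
    (.of_forall fun ρ => ?_)
    integrable_inv_one_add_sq.integrableOn ?_
  · filter_upwards [ae_restrict_mem measurableSet_Ioi] with s hs
    have hs : 0 < s := hs
    rw [Real.norm_of_nonneg (by positivity)]
    exact lumpIntegrand_le hn ρ hs
  · filter_upwards [ae_restrict_mem measurableSet_Ioi] with s hs
    have hs : 0 < s := hs
    refine tendsto_nhdsWithin_of_tendsto_nhds (ContinuousAt.tendsto
      (f := fun ρ : ℝ => s ^ n / ((ρ ^ 2 + s) ^ 2 * (1 + s ^ n) ^ 2)) ?_)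
    exact ContinuousAt.div (by fun_prop) (by fun_prop) (by positivity)

lemma integral_lumpIntegrand_zero_pos {n : ℕ} (hn : 2 ≤ n) :
    0 < ∫ s in Ioi (0:ℝ), s ^ n / (((0:ℝ) ^ 2 + s) ^ 2 * (1 + s ^ n) ^ 2) := by
  have hpos : ∀ s ∈ Ioi (0:ℝ), 0 < s ^ n / (((0:ℝ) ^ 2 + s) ^ 2 * (1 + s ^ n) ^ 2) := by
    intro s hs
    have hs : 0 < s := hs
    positivity
  rw [setIntegral_pos_iff_support_of_nonneg_ae _ (integrableOn_lumpIntegrand hn 0),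
    inter_eq_self_of_subset_right (s := Function.support _) fun s hs => (hpos s hs).ne']
  · simp
  · filter_upwards [ae_restrict_mem measurableSet_Ioi] with s hs using (hpos s hs).le

lemma tendsto_integral_sq_mul_lumpDerivIntegrand {n : ℕ} (hn : 2 ≤ n) :
    Tendsto (fun ρ : ℝ => ∫ s in Ioi (0:ℝ), ρ ^ 2 * (s ^ n / ((ρ ^ 2 + s) ^ 3 * (1 + s ^ n) ^ 2)))
      (𝓝[>] 0) (𝓝 0) := by
  rw [show 𝓝 (0:ℝ) = 𝓝 (∫ _ in Ioi (0:ℝ), (0:ℝ)) by rw [integral_zero]]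
  refine tendsto_integral_filter_of_dominated_convergence (fun s => (1 + s ^ 2)⁻¹)
    (.of_forall fun ρ => Measurable.aestronglyMeasurable (by fun_prop))
    (.of_forall fun ρ => ?_)
    integrable_inv_one_add_sq.integrableOn ?_
  · filter_upwards [ae_restrict_mem measurableSet_Ioi] with s hs
    have hs : 0 < s := hs
    rw [Real.norm_of_nonneg (by positivity)]
    exact sq_mul_lumpDerivIntegrand_le hn ρ hs
  · filter_upwards [ae_restrict_mem measurableSet_Ioi] with s hs
    have hs : 0 < s := hs
    have hcont : ContinuousAt
        (fun ρ : ℝ => ρ ^ 2 * (s ^ n / ((ρ ^ 2 + s) ^ 3 * (1 + s ^ n) ^ 2))) 0 :=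
      ContinuousAt.mul (by fun_prop)
        (ContinuousAt.div (by fun_prop) (by fun_prop) (by positivity))
    simpa using tendsto_nhdsWithin_of_tendsto_nhds (s := Ioi 0) hcont.tendsto

/-- For every integer `n ≥ 2`, `lim_{ρ→0⁺} ρ F̃ₙ'(ρ) / (2 F̃ₙ(ρ)) = 0`, where
`F̃ₙ(ρ) = π n² ∫₀^∞ sⁿ / ((ρ²+s)² (1+sⁿ)²) ds` and `F̃ₙ'` is its derivative. -/
theorem G_limit_at_zero (n : ℕ) (hn : 2 ≤ n) (F : ℝ → ℝ)
    (hF : ∀ ρ : ℝ, F ρ = π * (n:ℝ)^2 * ∫ s in Ioi (0:ℝ),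
      s ^ n / ((ρ^2 + s)^2 * (1 + s^n)^2)) :
    Tendsto (fun ρ : ℝ => ρ * deriv F ρ / (2 * F ρ)) (𝓝[>] 0) (𝓝 0) := by
  have hlim := ((tendsto_integral_sq_mul_lumpDerivIntegrand hn).const_mul (-2)).div
    (tendsto_integral_lumpIntegrand hn) (integral_lumpIntegrand_zero_pos hn).ne'
  rw [mul_zero, zero_div] at hlim
  refine hlim.congr' ?_
  filter_upwards [self_mem_nhdsWithin] with ρ hρ
  have hn0 : (n : ℝ) ≠ 0 := by
    norm_cast
    omega
  have hderiv := (hasDerivAt_integral_lumpIntegrand hn hρ).const_mul (π * (n:ℝ) ^ 2)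
  rw [← funext hF] at hderiv
  rw [hderiv.deriv, hF ρ, Pi.div_apply, integral_const_mul, integral_const_mul,
    ← mul_div_mul_left _ _ (show 2 * (π * (n:ℝ) ^ 2) ≠ 0 by positivity)]
  congr 1 <;> ring
end

section
/- For every integer n ≥ 2, lim_{χ→0⁺} ( 1 + χ F_n'(χ) / (2 F_n(χ)) ) = 1/n, where F_n(χ) = 2π ∫₀^∞ r^{2n+1} / ((1+r²)² (1+χ² r^{2n})²) dr and F_n' is its derivative. Equivalently, the conical singularity of R_eq,n at χ = 0 has deficit angle 2π(1 − 1/n). -/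
open MeasureTheory Real Set Filter Topology

/-- The radial density whose integral over `(0, ∞)` is `Fₙ(c) / (2π)`. -/
noncomputable def lumpDensity (n : ℕ) (c r : ℝ) : ℝ :=
  r ^ (2*n+1) / ((1 + r^2)^2 * (1 + c^2 * r^(2*n))^2)

/-- The ratio `c² r^(2n) / (1 + c² r^(2n))` lies in `[0, 1)`; it weights the
logarithmic derivative of `lumpDensity` in `c`. -/
noncomputable def lumpWeight (n : ℕ) (c r : ℝ) : ℝ :=
  c^2 * r^(2*n) / (1 + c^2 * r^(2*n))

lemma one_add_sq_mul_pow_pos (n : ℕ) (c r : ℝ) : 0 < 1 + c^2 * r^(2*n) := by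
  have := (even_two_mul n).pow_nonneg r
  positivity

lemma lumpDensity_nonneg (n : ℕ) (c : ℝ) {r : ℝ} (hr : 0 ≤ r) : 0 ≤ lumpDensity n c r := by
  unfold lumpDensity
  positivity

lemma lumpWeight_nonneg (n : ℕ) (c r : ℝ) : 0 ≤ lumpWeight n c r := by
  have := (even_two_mul n).pow_nonneg r
  unfold lumpWeight
  positivity

lemma lumpWeight_le_one (n : ℕ) (c r : ℝ) : lumpWeight n c r ≤ 1 := by
  rw [lumpWeight, div_le_one (one_add_sq_mul_pow_pos n c r)]
  linarith

lemma continuous_lumpDensity (n : ℕ) (c : ℝ) : Continuous (lumpDensity n c) := by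
  unfold lumpDensity
  refine Continuous.div (by fun_prop) (by fun_prop) fun r => ?_
  have := one_add_sq_mul_pow_pos n c r
  positivity

lemma continuous_lumpWeight (n : ℕ) (c : ℝ) : Continuous (lumpWeight n c) := by
  unfold lumpWeight
  exact Continuous.div (by fun_prop) (by fun_prop) fun r => (one_add_sq_mul_pow_pos n c r).ne'

lemma lumpDensity_anti (n : ℕ) {c d r : ℝ} (hc : 0 ≤ c) (hcd : c ≤ d) (hr : 0 ≤ r) :
    lumpDensity n d r ≤ lumpDensity n c r := by
  unfold lumpDensity
  gcongr

lemma lumpDensity_le (n : ℕ) {c r : ℝ} (hc : 0 < c) (hr : 0 ≤ r) :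
    lumpDensity n c r ≤ (c^2)⁻¹ * (1 + r^2)⁻¹ := by
  have hu := one_add_sq_mul_pow_pos n c r
  have h1 : r ≤ 1 + r^2 := by nlinarith [sq_nonneg (r - 1)]
  have h2 : c^2 * r^(2*n) ≤ (1 + c^2 * r^(2*n))^2 := by
    have : 0 ≤ c^2 * r^(2*n) := by positivity
    nlinarith
  rw [lumpDensity, ← mul_inv, ← one_div, div_le_div_iff₀ (by positivity) (by positivity)]
  calc r^(2*n+1) * (c^2 * (1 + r^2)) = (1 + r^2) * (r * (c^2 * r^(2*n))) := by ring
    _ ≤ (1 + r^2) * ((1 + r^2) * (1 + c^2 * r^(2*n))^2) := by gcongr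
    _ = _ := by ring

lemma lumpDensity_le_one_add_sq_pow (n : ℕ) (c : ℝ) {r : ℝ} (hr : 0 ≤ r) :
    lumpDensity n c r ≤ (1 + r^2)^(n+1) := by
  have h1 : r ≤ 1 + r^2 := by nlinarith [sq_nonneg (r - 1)]
  have h2 : r^2 ≤ 1 + r^2 := by linarith
  unfold lumpDensity
  refine (div_le_self (by positivity) ?_).trans ?_
  · have : 0 ≤ c^2 * r^(2*n) := by positivity
    exact one_le_mul_of_one_le_of_one_le (one_le_pow₀ (by nlinarith)) (one_le_pow₀ (by linarith))
  · rw [pow_succ, pow_succ, pow_mul]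
    gcongr

lemma integrableOn_lumpDensity (n : ℕ) {c : ℝ} (hc : 0 < c) :
    IntegrableOn (lumpDensity n c) (Ioi 0) := by
  refine Integrable.mono' ((integrable_inv_one_add_sq.const_mul (c^2)⁻¹).integrableOn)
    (continuous_lumpDensity n c).aestronglyMeasurable ?_
  filter_upwards [ae_restrict_mem measurableSet_Ioi] with r hr
  rw [norm_of_nonneg (lumpDensity_nonneg n c hr.le)]
  exact lumpDensity_le n hc hr.le

lemma integrableOn_mul_lumpDensity (n : ℕ) {c : ℝ} (hc : 0 < c) {w : ℝ → ℝ}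
    (hw : Continuous w) (h0 : ∀ r, 0 ≤ w r) (h1 : ∀ r, w r ≤ 1) :
    IntegrableOn (fun r => w r * lumpDensity n c r) (Ioi 0) := by
  refine Integrable.mono' (integrableOn_lumpDensity n hc)
    (hw.mul (continuous_lumpDensity n c)).aestronglyMeasurable ?_
  filter_upwards [ae_restrict_mem measurableSet_Ioi] with r hr
  have hf := lumpDensity_nonneg n c (le_of_lt hr)
  rw [norm_of_nonneg (mul_nonneg (h0 r) hf)]
  exact mul_le_of_le_one_left hf (h1 r)

lemma integrableOn_lumpWeight_mul (n : ℕ) {c : ℝ} (hc : 0 < c) :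
    IntegrableOn (fun r => lumpWeight n c r * lumpDensity n c r) (Ioi 0) :=
  integrableOn_mul_lumpDensity n hc (continuous_lumpWeight n c) (lumpWeight_nonneg n c)
    (lumpWeight_le_one n c)

lemma integrableOn_inv_one_add_sq_mul (n : ℕ) {c : ℝ} (hc : 0 < c) :
    IntegrableOn (fun r => (1 + r^2)⁻¹ * lumpDensity n c r) (Ioi 0) :=
  integrableOn_mul_lumpDensity n hc
    (Continuous.inv₀ (by fun_prop) fun r => by positivity) (fun r => by positivity)
    fun r => inv_le_one_of_one_le₀ (by nlinarith)

lemma hasDerivAt_lumpDensity_left (n : ℕ) {c : ℝ} (hc : c ≠ 0) (r : ℝ) :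
    HasDerivAt (fun x => lumpDensity n x r)
      (-(4 / c) * (lumpWeight n c r * lumpDensity n c r)) c := by
  have hu := one_add_sq_mul_pow_pos n c r
  have h := (((((hasDerivAt_id c).pow 2).mul_const (r^(2*n))).const_add 1).pow 2).const_mul
    ((1 + r^2)^2)
  have h' := (hasDerivAt_const c (r^(2*n+1))).div h (by simp only [id, Pi.pow_apply]; positivity)
  refine h'.congr_deriv ?_
  simp only [lumpWeight, lumpDensity, id, Pi.pow_apply]
  field_simp
  ring

lemma hasDerivAt_mul_lumpDensity (n : ℕ) (c : ℝ) {r : ℝ} (hr : r ≠ 0) :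
    HasDerivAt (fun r => r * lumpDensity n c r)
      ((2*n - 2) * lumpDensity n c r + 4 * ((1 + r^2)⁻¹ * lumpDensity n c r)
        - 4 * n * (lumpWeight n c r * lumpDensity n c r)) r := by
  have hu := one_add_sq_mul_pow_pos n c r
  have hp (k : ℕ) : HasDerivAt (fun x : ℝ => x^k) (k * r^k / r) r := by
    refine (hasDerivAt_pow k r).congr_deriv ?_
    rcases k with _ | k
    · simp
    · field_simp
      simp [pow_succ]
  have h := (((hp 2).const_add 1).pow 2).mul ((((hp (2*n)).const_mul (c^2)).const_add 1).pow 2)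
  have h' := (hasDerivAt_id r).mul ((hp (2*n+1)).div h (by
    simp only [Pi.mul_apply, Pi.pow_apply]; positivity))
  refine h'.congr_deriv ?_
  simp only [lumpWeight, lumpDensity, id, Pi.pow_apply, Pi.mul_apply, Pi.div_apply]
  push_cast
  rw [pow_succ r (2*n)]
  field_simp
  ring

lemma tendsto_mul_lumpDensity (n : ℕ) {c : ℝ} (hc : 0 < c) :
    Tendsto (fun r => r * lumpDensity n c r) atTop (𝓝 0) := by
  have h : Tendsto (fun r : ℝ => (c^2)⁻¹ * r⁻¹) atTop (𝓝 0) := by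
    simpa using tendsto_inv_atTop_zero.const_mul (c^2)⁻¹
  refine squeeze_zero' ?_ ?_ h <;> filter_upwards [eventually_gt_atTop 0] with r hr
  · exact mul_nonneg hr.le (lumpDensity_nonneg n c hr.le)
  · refine (mul_le_mul_of_nonneg_left (lumpDensity_le n hc hr.le) hr.le).trans ?_
    rw [mul_left_comm]
    gcongr
    rw [← div_eq_mul_inv, ← one_div, div_le_div_iff₀ (by positivity) hr]
    nlinarith

lemma integral_lumpWeight_mul (n : ℕ) {c : ℝ} (hc : 0 < c) :
    4 * n * ∫ r in Ioi 0, lumpWeight n c r * lumpDensity n c r =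
      (2*n - 2) * (∫ r in Ioi 0, lumpDensity n c r)
        + 4 * ∫ r in Ioi 0, (1 + r^2)⁻¹ * lumpDensity n c r := by
  have hf := (integrableOn_lumpDensity n hc).const_mul (2*n - 2 : ℝ)
  have hd := (integrableOn_inv_one_add_sq_mul n hc).const_mul 4
  have hw := (integrableOn_lumpWeight_mul n hc).const_mul (4 * n : ℝ)
  have h := integral_Ioi_of_hasDerivAt_of_tendsto
    (continuous_id.mul (continuous_lumpDensity n c)).continuousWithinAt
    (fun r hr => hasDerivAt_mul_lumpDensity n c (ne_of_gt hr))
    ((hf.add hd).sub hw) (tendsto_mul_lumpDensity n hc)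
  have hsub := integral_sub (hf.add hd) hw
  simp only [Pi.add_apply] at hsub
  rw [hsub, integral_add hf hd] at h
  simp only [integral_const_mul, Pi.mul_apply, id, zero_mul] at h
  linarith

lemma hasDerivAt_integral_lumpDensity (n : ℕ) {c : ℝ} (hc : 0 < c) :
    HasDerivAt (fun x => ∫ r in Ioi 0, lumpDensity n x r)
      (-(4 / c) * ∫ r in Ioi 0, lumpWeight n c r * lumpDensity n c r) c := by
  rw [← integral_const_mul]
  have hs : Ioi (c/2) ∈ 𝓝 c := Ioi_mem_nhds (by linarith)
  refine (hasDerivAt_integral_of_dominated_loc_of_deriv_le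
    (F' := fun x r => -(4 / x) * (lumpWeight n x r * lumpDensity n x r))
    (bound := fun r => 8 / c * lumpDensity n (c/2) r) hs
    (.of_forall fun x => (continuous_lumpDensity n x).aestronglyMeasurable)
    (integrableOn_lumpDensity n hc)
    (((integrableOn_lumpWeight_mul n hc).const_mul _).aestronglyMeasurable) ?_
    ((integrableOn_lumpDensity n (half_pos hc)).const_mul _) ?_).2
  · filter_upwards [ae_restrict_mem measurableSet_Ioi] with r hr x hx
    have hr' : 0 ≤ r := le_of_lt hr
    have hx' : c / 2 < x := hx
    have hx0 : 0 < x := by linarith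
    have hf := lumpDensity_nonneg n x hr'
    have hw := lumpWeight_nonneg n x r
    rw [neg_mul, norm_neg, norm_of_nonneg (by positivity)]
    have h4 : 4 / x ≤ 8 / c := by
      rw [div_le_div_iff₀ hx0 hc]
      linarith
    have h := (mul_le_of_le_one_left hf (lumpWeight_le_one n x r)).trans
      (lumpDensity_anti n (by positivity) hx'.le hr')
    gcongr
  · filter_upwards with r x hx
    have hx' : c / 2 < x := hx
    exact hasDerivAt_lumpDensity_left n (by linarith) r

lemma tendsto_integral_lumpDensity {n : ℕ} (hn : 2 ≤ n) :
    Tendsto (fun c => ∫ r in Ioi 0, lumpDensity n c r) (𝓝[>] 0) atTop := by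
  refine tendsto_atTop.2 fun b => ?_
  set M : ℝ := 1 + 16 * |b|
  have hM : 1 ≤ M := by simp [M]
  have hM0 : 0 < (M^n)⁻¹ := by positivity
  filter_upwards [self_mem_nhdsWithin, nhdsWithin_le_nhds (Iio_mem_nhds hM0)] with c hc hcM
  have hc0 : 0 < c := hc
  have hbound : ∀ r ∈ Ioc 1 M, (1/16 : ℝ) ≤ lumpDensity n c r := by
    intro r hr
    have h1 : 1 ≤ r := hr.1.le
    have h2 : c * r^n ≤ 1 := by
      calc c * r^n ≤ (M^n)⁻¹ * M^n := by
            gcongr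
            exacts [le_of_lt hcM, hr.2]
        _ = 1 := inv_mul_cancel₀ (by positivity)
    have h3 : c^2 * r^(2*n) ≤ 1 := by
      rw [mul_comm 2 n, pow_mul, ← mul_pow]
      exact pow_le_one₀ (by positivity) h2
    have h4 : r^4 ≤ r^(2*n+1) := pow_le_pow_right₀ h1 (by omega)
    rw [lumpDensity, div_le_div_iff₀ (by norm_num) (by positivity)]
    calc 1 * ((1 + r^2)^2 * (1 + c^2 * r^(2*n))^2)
        ≤ 1 * ((r^2 + r^2)^2 * (1 + 1)^2) := by
          gcongr
          exact one_le_pow₀ h1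
      _ = r^4 * 16 := by ring
      _ ≤ _ := by gcongr
  calc b ≤ |b| := le_abs_self b
    _ = ∫ _ in Ioc 1 M, (1/16 : ℝ) := by
      simp [M]
      ring
    _ ≤ ∫ r in Ioc 1 M, lumpDensity n c r :=
      setIntegral_mono_on (by simp) ((integrableOn_lumpDensity n hc0).mono_set
        fun r hr => zero_lt_one.trans hr.1) measurableSet_Ioc hbound
    _ ≤ ∫ r in Ioi 0, lumpDensity n c r := by
      refine setIntegral_mono_set (integrableOn_lumpDensity n hc0) ?_
        (LE.le.eventuallyLE fun r hr => zero_lt_one.trans hr.1)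
      filter_upwards [ae_restrict_mem measurableSet_Ioi] with r hr
      exact lumpDensity_nonneg n c (le_of_lt hr)

lemma integral_inv_one_add_sq_mul_le (n : ℕ) {c δ : ℝ} (hc : 0 < c) (hδ : 0 < δ) :
    ∫ r in Ioi 0, (1 + r^2)⁻¹ * lumpDensity n c r ≤
      δ * (∫ r in Ioi 0, lumpDensity n c r)
        + (δ⁻¹)^(n+1) * ∫ r in Ioi (0:ℝ), (1 + r^2)⁻¹ := by
  have h1 := (integrableOn_lumpDensity n hc).const_mul δ
  have h2 : IntegrableOn (fun r : ℝ => (δ⁻¹)^(n+1) * (1 + r^2)⁻¹) (Ioi 0) :=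
    (integrable_inv_one_add_sq.const_mul _).integrableOn
  rw [← integral_const_mul, ← integral_const_mul, ← integral_add h1 h2]
  refine setIntegral_mono_on (integrableOn_inv_one_add_sq_mul n hc) (h1.add h2)
    measurableSet_Ioi fun r hr => ?_
  have hf := lumpDensity_nonneg n c (le_of_lt hr)
  rcases le_total (1 + r^2)⁻¹ δ with h | h
  · have : (1 + r^2)⁻¹ * lumpDensity n c r ≤ δ * lumpDensity n c r := by gcongr
    have : 0 ≤ (δ⁻¹)^(n+1) * (1 + r^2)⁻¹ := by positivity
    linarith
  · have h' : 1 + r^2 ≤ δ⁻¹ := (le_inv_comm₀ hδ (by positivity)).1 h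
    have : (1 + r^2)⁻¹ * lumpDensity n c r ≤ (1 + r^2)⁻¹ * (δ⁻¹)^(n+1) := by
      gcongr
      exact (lumpDensity_le_one_add_sq_pow n c (le_of_lt hr)).trans (by gcongr)
    have : 0 ≤ δ * lumpDensity n c r := by positivity
    linarith

lemma tendsto_integral_inv_one_add_sq_mul_div {n : ℕ} (hn : 2 ≤ n) :
    Tendsto (fun c => (∫ r in Ioi 0, (1 + r^2)⁻¹ * lumpDensity n c r) /
      ∫ r in Ioi 0, lumpDensity n c r) (𝓝[>] 0) (𝓝 0) := by
  refine tendsto_order.2 ⟨fun a ha => ?_, fun a ha => ?_⟩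
  · filter_upwards with c
    refine ha.trans_le (div_nonneg ?_ ?_) <;>
      refine setIntegral_nonneg measurableSet_Ioi fun r hr => ?_
    · have := lumpDensity_nonneg n c (le_of_lt hr)
      positivity
    · exact lumpDensity_nonneg n c (le_of_lt hr)
  · have hA := tendsto_integral_lumpDensity hn
    set K : ℝ := ((a/2)⁻¹)^(n+1) * ∫ r in Ioi (0:ℝ), (1 + r^2)⁻¹ with hK
    filter_upwards [self_mem_nhdsWithin, hA.eventually_gt_atTop 0,
      hA.eventually_gt_atTop (K / (a/2))] with c hc h0 h1
    rw [div_lt_iff₀ (half_pos ha)] at h1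
    rw [div_lt_iff₀ h0]
    have := integral_inv_one_add_sq_mul_le n hc (half_pos ha)
    linarith

/-- For every integer `n ≥ 2`, `lim_{χ→0⁺} (1 + χ Fₙ'(χ) / (2 Fₙ(χ))) = 1/n`, where
`Fₙ(χ) = 2π ∫₀^∞ r^(2n+1) / ((1+r²)² (1+χ² r^(2n))²) dr` and `Fₙ'` is its derivative;
equivalently, the conical singularity of `R_eq,n` at `χ = 0` has deficit angle
`2π(1 − 1/n)`. -/
theorem sin_xi_limit (n : ℕ) (hn : 2 ≤ n) (F : ℝ → ℝ)
    (hF : ∀ χ : ℝ, F χ = 2 * π * ∫ r in Ioi (0:ℝ),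
      r ^ (2*n+1) / ((1 + r^2)^2 * (1 + χ^2 * r^(2*n))^2)) :
    Tendsto (fun χ : ℝ => 1 + χ * deriv F χ / (2 * F χ)) (𝓝[>] 0)
      (𝓝 (1 / (n:ℝ))) := by
  have hn0 : (n:ℝ) ≠ 0 := by positivity
  have hFA : F = fun c => 2 * π * ∫ r in Ioi 0, lumpDensity n c r := funext hF
  have hlim : Tendsto (fun c => (1 - 2 * ((∫ r in Ioi 0, (1 + r^2)⁻¹ * lumpDensity n c r) /
      ∫ r in Ioi 0, lumpDensity n c r)) / n) (𝓝[>] 0) (𝓝 (1 / (n:ℝ))) := by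
    simpa using (((tendsto_integral_inv_one_add_sq_mul_div hn).const_mul 2).const_sub 1).div_const
      (n:ℝ)
  refine hlim.congr' ?_
  filter_upwards [self_mem_nhdsWithin,
    (tendsto_integral_lumpDensity hn).eventually_gt_atTop 0] with c hc hA
  have hc0 : 0 < c := hc
  have hB := integral_lumpWeight_mul n hc0
  rw [hFA, ((hasDerivAt_integral_lumpDensity n hc0).const_mul (2 * π)).deriv]
  generalize (∫ r in Ioi 0, (1 + r^2)⁻¹ * lumpDensity n c r) = D at hB ⊢
  generalize (∫ r in Ioi 0, lumpWeight n c r * lumpDensity n c r) = B at hB ⊢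
  field_simp
  linarith
end

section
/- Let n ≥ 1 be an integer and let p, q ∈ ℂ[z] be coprime polynomials with max(deg p, deg q) = n and p not the zero polynomial. Suppose that for all α ∈ ℝ and all z ∈ ℂ, e^{inα} p(e^{-iα} z) q(z) = p(z) q(e^{-iα} z). Then q is a nonzero constant polynomial and p(z) = a z^n for some a ∈ ℂ, a ≠ 0. -/
open Polynomial Complex

/-- A nonzero polynomial dividing its own rescaling by a primitive root of unity of order larger
than its degree is a monomial. -/
lemma eq_C_mul_X_pow_of_dvd_comp {K : Type*} [Field K] {q : Polynomial K} {w : K} {N : ℕ}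
    (hw : IsPrimitiveRoot w N) (hN : q.natDegree < N) (hq : q ≠ 0)
    (hdvd : q ∣ q.comp (Polynomial.C w * Polynomial.X)) :
    q = Polynomial.C q.leadingCoeff * Polynomial.X ^ q.natDegree := by
  have hw0 : w ≠ 0 := hw.ne_zero (by omega)
  obtain ⟨r, hr⟩ := hdvd
  have hcomp : (q.comp (Polynomial.C w * Polynomial.X)).natDegree = q.natDegree := by
    rw [Polynomial.natDegree_comp, Polynomial.natDegree_C_mul_X w hw0, mul_one]
  have hr0 : r ≠ 0 := by
    rintro rfl
    have h := congrArg (fun f => Polynomial.coeff f q.natDegree) hr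
    simp [Polynomial.comp_C_mul_X_coeff, hq, hw0] at h
  have hrdeg : r.natDegree = 0 := by
    rw [hr, Polynomial.natDegree_mul hq hr0] at hcomp
    omega
  obtain ⟨c, rfl⟩ := Polynomial.natDegree_eq_zero.mp hrdeg
  have hcoeff : ∀ k, q.coeff k ≠ 0 → w ^ k = c := by
    intro k hk
    have h := congrArg (fun f => Polynomial.coeff f k) hr
    simp only [Polynomial.comp_C_mul_X_coeff, Polynomial.coeff_mul_C] at h
    exact mul_left_cancel₀ hk h
  ext k
  rw [Polynomial.coeff_C_mul_X_pow]
  split_ifs with hk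
  · rw [hk, Polynomial.coeff_natDegree]
  · by_contra hne
    have hlt : k < N := (Polynomial.le_natDegree_of_ne_zero hne).trans_lt hN
    refine hk (hw.pow_inj hlt hN ?_)
    rw [hcoeff k hne, hcoeff q.natDegree (by simpa using hq)]

/-- Let `n ≥ 1` and let `p, q ∈ ℂ[z]` be coprime polynomials with
`max (deg p) (deg q) = n` and `p ≠ 0`. If for all `α ∈ ℝ` and `z ∈ ℂ`,
`e^(i n α) p(e^(-i α) z) q(z) = p(z) q(e^(-i α) z)`, then `q` is a nonzero constant
and `p(z) = a zⁿ` for some `a ≠ 0`. -/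
theorem equivariant_rational_maps (n : ℕ) (hn : 1 ≤ n) (p q : Polynomial ℂ)
    (hcop : IsCoprime p q) (hdeg : max p.natDegree q.natDegree = n) (hp : p ≠ 0)
    (hfix : ∀ α : ℝ, ∀ z : ℂ,
      Complex.exp ((n : ℂ) * α * Complex.I) *
        p.eval (Complex.exp (-(α : ℂ) * Complex.I) * z) * q.eval z =
      p.eval z * q.eval (Complex.exp (-(α : ℂ) * Complex.I) * z)) :
    (∃ c : ℂ, c ≠ 0 ∧ q = Polynomial.C c) ∧
    (∃ a : ℂ, a ≠ 0 ∧ p = Polynomial.C a * Polynomial.X ^ n) := by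
  have hq : q ≠ 0 := by
    rintro rfl
    have h := Polynomial.natDegree_eq_zero_of_isUnit (isCoprime_zero_right.mp hcop)
    simp [h] at hdeg
    omega
  have hpn : p.natDegree ≤ n := hdeg ▸ le_max_left _ _
  have hqn : q.natDegree ≤ n := hdeg ▸ le_max_right _ _
  obtain ⟨w, hw, v, hv, hvw, hid⟩ : ∃ w : ℂ, IsPrimitiveRoot w (2 * n + 1) ∧ ∃ v : ℂ, v ≠ 0 ∧
      v * w ^ n = 1 ∧ Polynomial.C v * p.comp (Polynomial.C w * Polynomial.X) * q =
        p * q.comp (Polynomial.C w * Polynomial.X) := by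
    set α : ℝ := -(2 * Real.pi / ((2 * n + 1 : ℕ) : ℝ)) with hα
    have hprim := Complex.isPrimitiveRoot_exp (2 * n + 1) (by omega)
    have hexp : 2 * (Real.pi : ℂ) * Complex.I / ((2 * n + 1 : ℕ) : ℂ) = -(α : ℂ) * Complex.I := by
      rw [hα]
      push_cast
      ring
    rw [hexp] at hprim
    refine ⟨_, hprim, Complex.exp ((n : ℂ) * α * Complex.I), Complex.exp_ne_zero _, ?_, ?_⟩
    · rw [← Complex.exp_nat_mul, ← Complex.exp_add, ← Complex.exp_zero]
      congr 1
      ring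
    · refine Polynomial.funext fun z => ?_
      simpa using hfix α z
  have hqdvd : q ∣ q.comp (Polynomial.C w * Polynomial.X) :=
    hcop.symm.dvd_of_dvd_mul_left (hid ▸ dvd_mul_left _ _)
  have hpdvd : p ∣ p.comp (Polynomial.C w * Polynomial.X) := by
    have h : p ∣ Polynomial.C v * p.comp (Polynomial.C w * Polynomial.X) :=
      hcop.dvd_of_dvd_mul_right (hid ▸ dvd_mul_right _ _)
    exact (Polynomial.isUnit_C.mpr hv.isUnit).dvd_mul_left.mp h
  have hqm := eq_C_mul_X_pow_of_dvd_comp hw (by omega) hq hqdvd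
  have hpm := eq_C_mul_X_pow_of_dvd_comp hw (by omega) hp hpdvd
  have ha : p.leadingCoeff ≠ 0 := Polynomial.leadingCoeff_ne_zero.mpr hp
  have hb : q.leadingCoeff ≠ 0 := Polynomial.leadingCoeff_ne_zero.mpr hq
  generalize p.leadingCoeff = a at hpm ha
  generalize q.leadingCoeff = b at hqm hb
  generalize p.natDegree = m at hpm hpn
  generalize q.natDegree = k at hqm hqn
  have h1 : v * w ^ m = w ^ k := by
    have h := congrArg (Polynomial.eval 1) hid
    simp only [hpm, hqm, Polynomial.eval_mul, Polynomial.eval_comp, Polynomial.eval_C,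
      Polynomial.eval_X, Polynomial.eval_pow, one_pow, mul_one] at h
    refine mul_left_cancel₀ (mul_ne_zero ha hb) ?_
    linear_combination h
  have h2 : w ^ m = w ^ (n + k) := by
    rw [pow_add, ← h1]
    linear_combination (-w ^ m) * hvw
  have h3 : m = n + k := hw.pow_inj (by omega) (by omega) h2
  obtain rfl : k = 0 := by omega
  obtain rfl : m = n := by omega
  exact ⟨⟨b, hb, by simpa using hqm⟩, ⟨a, ha, hpm⟩⟩
end

section
/- For every integer n ≥ 4, the Gauss curvature of the lifted metric, κ̃_n(ρ) = -(1/(ρ F̃_n(ρ))) · d/dρ ( ρ F̃_n'(ρ) / (2 F̃_n(ρ)) ), is a bounded function on (0,∞), where F̃_n(ρ) = π n² ∫₀^∞ s^n / ((ρ²+s)² (1+s^n)²) ds; consequently the Gauss curvature of the equivariant moduli space R_eq,n is bounded for n ≥ 4. -/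
open MeasureTheory Real Set

/-- The generalized Stieltjes transform `x ↦ ∫₀^∞ w(s) / (x + s)^k ds` of a weight `w`. -/
noncomputable def stieltjes (w : ℝ → ℝ) (k : ℕ) (x : ℝ) : ℝ :=
  ∫ s in Ioi (0:ℝ), w s / (x + s) ^ k

theorem integrableOn_div_add_pow {w : ℝ → ℝ} (hw : IntegrableOn w (Ioi 0)) (k : ℕ) {x : ℝ}
    (hx : 0 < x) : IntegrableOn (fun s => w s / (x + s) ^ k) (Ioi 0) := by
  refine Integrable.mono' (hw.norm.mul_const ((x ^ k)⁻¹)) ?_ ?_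
  · simp only [div_eq_mul_inv]
    exact hw.aestronglyMeasurable.mul (by fun_prop : Measurable fun s : ℝ =>
      ((x + s) ^ k)⁻¹).aestronglyMeasurable
  · refine (ae_restrict_iff' measurableSet_Ioi).2 (ae_of_all _ fun s hs => ?_)
    have hs : 0 < s := hs
    rw [norm_div, div_eq_mul_inv, Real.norm_of_nonneg (by positivity : 0 ≤ (x + s) ^ k)]
    gcongr
    linarith

theorem hasDerivAt_stieltjes {w : ℝ → ℝ} (hw : IntegrableOn w (Ioi 0)) (k : ℕ) {x : ℝ}
    (hx : 0 < x) : HasDerivAt (stieltjes w k) (-k * stieltjes w (k + 1) x) x := by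
  have key := hasDerivAt_integral_of_dominated_loc_of_deriv_le
    (μ := volume.restrict (Ioi (0:ℝ))) (F := fun y s => w s / (y + s) ^ k)
    (F' := fun y s => -k * (w s / (y + s) ^ (k + 1))) (x₀ := x) (s := Ioi (x / 2))
    (bound := fun s => k * (‖w s‖ * ((x / 2) ^ (k + 1))⁻¹))
    (Ioi_mem_nhds (by linarith)) ?_ (integrableOn_div_add_pow hw k hx) ?_ ?_ ?_ ?_
  · rw [stieltjes, ← integral_const_mul]
    exact key.2
  · filter_upwards [Ioi_mem_nhds hx] with y hy
    exact (integrableOn_div_add_pow hw k hy).aestronglyMeasurable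
  · exact ((integrableOn_div_add_pow hw (k + 1) hx).const_mul _).aestronglyMeasurable
  · refine (ae_restrict_iff' measurableSet_Ioi).2 (ae_of_all _ fun s hs y hy => ?_)
    have hs : 0 < s := hs
    have hy : x / 2 < y := hy
    have hy0 : 0 < y := by linarith
    rw [norm_mul, norm_div, norm_neg, Real.norm_natCast, div_eq_mul_inv,
      Real.norm_of_nonneg (by positivity : 0 ≤ (y + s) ^ (k + 1))]
    gcongr
    linarith
  · exact (hw.norm.mul_const _).const_mul _
  · refine (ae_restrict_iff' measurableSet_Ioi).2 (ae_of_all _ fun s hs y hy => ?_)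
    have hs : 0 < s := hs
    have hy : x / 2 < y := hy
    have hys : y + s ≠ 0 := by linarith
    have h := ((((hasDerivAt_id y).add_const s).pow k).inv (pow_ne_zero k hys)).const_mul (w s)
    refine h.congr_deriv ?_
    rcases k with _ | k
    · simp
    · simp only [id, Nat.add_sub_cancel, Pi.pow_apply]
      field_simp
      ring

theorem mul_stieltjes_succ_add {w : ℝ → ℝ} (hw : IntegrableOn w (Ioi 0))
    (hsw : IntegrableOn (fun s => s * w s) (Ioi 0)) (k : ℕ) {x : ℝ} (hx : 0 < x) :
    x * stieltjes w (k + 1) x + stieltjes (fun s => s * w s) (k + 1) x = stieltjes w k x := by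
  unfold stieltjes
  rw [← integral_const_mul, ← integral_add ((integrableOn_div_add_pow hw (k + 1) hx).const_mul x)
    (integrableOn_div_add_pow hsw (k + 1) hx)]
  refine setIntegral_congr_fun measurableSet_Ioi fun s hs => ?_
  have hs : 0 < s := hs
  have : x + s ≠ 0 := by positivity
  field_simp
  ring

theorem stieltjes_nonneg {w : ℝ → ℝ} (hw : ∀ s, 0 < s → 0 ≤ w s) (k : ℕ) {x : ℝ} (hx : 0 < x) :
    0 ≤ stieltjes w k x := by
  refine setIntegral_nonneg measurableSet_Ioi fun s hs => ?_
  have hs : 0 < s := hs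
  have := hw s hs
  positivity

theorem stieltjes_le {w D : ℝ → ℝ} (hw : ∀ s, 0 < s → 0 ≤ w s) (hD : IntegrableOn D (Ioi 0))
    {k : ℕ} (hwD : ∀ s, 0 < s → w s * ((1 + s) / s) ^ k ≤ D s) {x : ℝ} (hx : 0 < x) :
    stieltjes w k x ≤ (∫ s in Ioi (0:ℝ), D s) / (1 + x) ^ k := by
  rw [← integral_div]
  refine integral_mono_of_nonneg ?_ (hD.div_const _) ?_
  · refine (ae_restrict_iff' measurableSet_Ioi).2 (ae_of_all _ fun s hs => ?_)
    have hs : 0 < s := hs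
    have := hw s hs
    simp only [Pi.zero_apply]
    positivity
  · refine (ae_restrict_iff' measurableSet_Ioi).2 (ae_of_all _ fun s hs => ?_)
    have hs : 0 < s := hs
    have h0 := hw s hs
    have h1 : (x + s)⁻¹ ≤ (1 + s) / s / (1 + x) := by
      rw [div_div, inv_eq_one_div, div_le_div_iff₀ (by positivity) (by positivity)]
      nlinarith [mul_pos hx hs]
    calc w s / (x + s) ^ k = w s * ((x + s)⁻¹) ^ k := by rw [inv_pow, div_eq_mul_inv]
      _ ≤ w s * ((1 + s) / s / (1 + x)) ^ k := by gcongr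
      _ = w s * ((1 + s) / s) ^ k / (1 + x) ^ k := by rw [div_pow _ (1 + x), mul_div_assoc]
      _ ≤ D s / (1 + x) ^ k := by gcongr; exact hwD s hs

theorem stieltjes_one_div_le {w : ℝ → ℝ} (hw : ∀ s, 0 < s → 0 ≤ w s)
    (hwi : IntegrableOn w (Ioi 0)) (k : ℕ) {x : ℝ} (hx : 0 < x) :
    stieltjes w k 1 / (1 + x) ^ k ≤ stieltjes w k x := by
  unfold stieltjes
  rw [← integral_div]
  refine setIntegral_mono_on ((integrableOn_div_add_pow hwi k one_pos).div_const _)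
    (integrableOn_div_add_pow hwi k hx) measurableSet_Ioi fun s hs => ?_
  have hs : 0 < s := hs
  have h0 := hw s hs
  rw [div_div, ← mul_pow]
  gcongr
  nlinarith [mul_pos hx hs]

theorem stieltjes_pos {w : ℝ → ℝ} (hw : ∀ s, 0 < s → 0 < w s)
    (hwi : IntegrableOn w (Ioi 0)) (k : ℕ) {x : ℝ} (hx : 0 < x) : 0 < stieltjes w k x := by
  have hpos : ∀ s ∈ Ioi (0:ℝ), 0 < w s / (x + s) ^ k := fun s hs => by
    have hs : 0 < s := hs
    have := hw s hs
    positivity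
  rw [stieltjes, setIntegral_pos_iff_support_of_nonneg_ae
    ((ae_restrict_iff' measurableSet_Ioi).2 (ae_of_all _ fun s hs => (hpos s hs).le))
    (integrableOn_div_add_pow hwi k hx)]
  have : Ioi (0:ℝ) ⊆ Function.support (fun s => w s / (x + s) ^ k) :=
    fun s hs => (hpos s hs).ne'
  rw [inter_eq_self_of_subset_right this]
  simp

theorem weight_mul_le {n : ℕ} (hn : 3 ≤ n) {s : ℝ} (hs : 0 < s) :
    s ^ n / (1 + s ^ n) ^ 2 * ((1 + s) ^ 4 / s ^ 3) ≤ 32 * (1 + s ^ 2)⁻¹ := by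
  obtain ⟨m, rfl⟩ := Nat.exists_eq_add_of_le hn
  have key : s ^ m * (1 + s) ^ 4 * (1 + s ^ 2) ≤ 32 * (1 + s ^ (3 + m)) ^ 2 := by
    rcases le_total s 1 with h | h
    · have h1 : s ^ m ≤ 1 := pow_le_one₀ hs.le h
      calc s ^ m * (1 + s) ^ 4 * (1 + s ^ 2) ≤ 1 * (1 + 1) ^ 4 * (1 + 1 ^ 2) := by gcongr
        _ ≤ 32 * (1 + s ^ (3 + m)) ^ 2 := by
          nlinarith [pow_pos hs (3 + m)]
    · have h1 : 1 ≤ s ^ m := one_le_pow₀ h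
      calc s ^ m * (1 + s) ^ 4 * (1 + s ^ 2) ≤ s ^ m * (s + s) ^ 4 * (s ^ 2 + s ^ 2) := by
            gcongr
            exact one_le_pow₀ h
        _ = 32 * (s ^ 6 * (s ^ m * 1)) := by ring
        _ ≤ 32 * (s ^ 6 * (s ^ m * s ^ m)) := by gcongr
        _ = 32 * (0 + s ^ (3 + m)) ^ 2 := by ring
        _ ≤ 32 * (1 + s ^ (3 + m)) ^ 2 := by gcongr; norm_num
  have e : s ^ (3 + m) / (1 + s ^ (3 + m)) ^ 2 * ((1 + s) ^ 4 / s ^ 3)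
      = s ^ m * (1 + s) ^ 4 / (1 + s ^ (3 + m)) ^ 2 := by
    rw [pow_add s 3 m]
    field_simp
  rw [e, ← div_eq_mul_inv, div_le_div_iff₀ (by positivity) (by positivity)]
  exact key

/-- For a conformal factor `F(ρ) = c ∫₀^∞ w(s) / (ρ² + s)² ds`, the Gauss curvature in terms of
Stieltjes transforms, in a form in which the leading terms at infinity have cancelled. -/
theorem conformal_curvature_eq {w F : ℝ → ℝ} {c : ℝ} (hc : 0 < c) (hw : ∀ s, 0 < s → 0 < w s)
    (hwi : IntegrableOn w (Ioi 0)) (hsw : IntegrableOn (fun s => s * w s) (Ioi 0))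
    (hF : ∀ ρ, F ρ = c * stieltjes w 2 (ρ ^ 2)) {ρ : ℝ} (hρ : 0 < ρ) :
    -(1 / (ρ * F ρ)) * deriv (fun t : ℝ => t * deriv F t / (2 * F t)) ρ =
      4 * (3 * stieltjes (fun s => s * w s) 4 (ρ ^ 2) * stieltjes w 2 (ρ ^ 2)
        - 2 * stieltjes w 3 (ρ ^ 2) * stieltjes (fun s => s * w s) 3 (ρ ^ 2))
        / (c * stieltjes w 2 (ρ ^ 2) ^ 3) := by
  have hsq : ∀ t : ℝ, HasDerivAt (fun t : ℝ => t ^ 2) (2 * t) t := fun t => by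
    simpa using hasDerivAt_pow 2 t
  have hF' : ∀ t, 0 < t → deriv F t = c * (-2 * stieltjes w 3 (t ^ 2) * (2 * t)) := fun t ht => by
    have h := ((hasDerivAt_stieltjes hwi 2 (pow_pos ht 2)).comp (h := fun t : ℝ => t ^ 2) t (hsq t)).const_mul c
    rw [funext hF]
    simpa using h.deriv
  have hlog : (fun t : ℝ => t * deriv F t / (2 * F t)) =ᶠ[nhds ρ]
      (fun x => -2 * (x * stieltjes w 3 x / stieltjes w 2 x)) ∘ fun t => t ^ 2 := by
    filter_upwards [Ioi_mem_nhds hρ] with t ht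
    have ht : 0 < t := ht
    have := stieltjes_pos hw hwi 2 (pow_pos ht 2)
    simp only [Function.comp, hF' t ht, hF t]
    field_simp
  have hx : 0 < ρ ^ 2 := pow_pos hρ 2
  have hpos := stieltjes_pos hw hwi 2 hx
  have h2 := hasDerivAt_stieltjes hwi 2 hx
  have h3 := hasDerivAt_stieltjes hwi 3 hx
  have hd := (((((hasDerivAt_id (ρ ^ 2)).mul h3).div h2 hpos.ne').const_mul (-2)).comp
    (h := fun t : ℝ => t ^ 2) ρ (hsq ρ)).deriv
  have e2 := mul_stieltjes_succ_add hwi hsw 2 hx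
  have e3 := mul_stieltjes_succ_add hwi hsw 3 hx
  rw [hlog.deriv_eq]
  refine (congrArg _ hd).trans ?_
  norm_num at e2 e3 ⊢
  rw [hF ρ]
  rw [← sub_eq_iff_eq_add'.2 e2.symm, ← sub_eq_iff_eq_add'.2 e3.symm]
  field_simp
  ring

/-- For every integer `n ≥ 4`, the Gauss curvature of the lifted metric,
`κ̃ₙ(ρ) = -(1/(ρ F̃ₙ(ρ))) · d/dρ (ρ F̃ₙ'(ρ) / (2 F̃ₙ(ρ)))`, is a bounded function on
`(0,∞)`, where `F̃ₙ(ρ) = π n² ∫₀^∞ sⁿ / ((ρ²+s)² (1+sⁿ)²) ds`. -/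
theorem gauss_curvature_bounded (n : ℕ) (hn : 4 ≤ n) (F : ℝ → ℝ) (κ : ℝ → ℝ)
    (hF : ∀ ρ : ℝ, F ρ = π * (n:ℝ)^2 * ∫ s in Ioi (0:ℝ),
      s ^ n / ((ρ^2 + s)^2 * (1 + s^n)^2))
    (hκ : ∀ ρ : ℝ, κ ρ = -(1 / (ρ * F ρ)) *
      deriv (fun t : ℝ => t * deriv F t / (2 * F t)) ρ) :
    ∃ C : ℝ, ∀ ρ ∈ Ioi (0:ℝ), |κ ρ| ≤ C := by
  set w : ℝ → ℝ := fun s => s ^ n / (1 + s ^ n) ^ 2 with hwdef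
  set D : ℝ → ℝ := fun s => 32 * (1 + s ^ 2)⁻¹ with hDdef
  have hw : ∀ s, 0 < s → 0 < w s := fun s hs => by simp only [hwdef]; positivity
  have hsw : ∀ s, 0 < s → 0 ≤ s * w s := fun s hs => (mul_pos hs (hw s hs)).le
  have hD : IntegrableOn D (Ioi 0) := (integrable_inv_one_add_sq.const_mul 32).integrableOn
  have hwD : ∀ s, 0 < s → ∀ r, r ≤ (1 + s) ^ 4 / s ^ 3 → w s * r ≤ D s := fun s hs r hr =>
    (mul_le_mul_of_nonneg_left hr (hw s hs).le).trans (weight_mul_le (by omega) hs)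
  have hwm : Measurable w := by simp only [hwdef]; fun_prop
  have hwi : IntegrableOn w (Ioi 0) := by
    refine Integrable.mono' hD hwm.aestronglyMeasurable
      ((ae_restrict_iff' measurableSet_Ioi).2 (ae_of_all _ fun s hs => ?_))
    have hs : 0 < s := hs
    rw [Real.norm_of_nonneg (hw s hs).le, ← mul_one (w s)]
    refine hwD s hs 1 ?_
    rw [le_div_iff₀ (by positivity)]
    nlinarith [pow_pos hs 2, pow_pos hs 3, pow_pos hs 4]
  have hswi : IntegrableOn (fun s => s * w s) (Ioi 0) := by
    refine Integrable.mono' hD (measurable_id.mul hwm).aestronglyMeasurable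
      ((ae_restrict_iff' measurableSet_Ioi).2 (ae_of_all _ fun s hs => ?_))
    have hs : 0 < s := hs
    rw [Real.norm_of_nonneg (hsw s hs), mul_comm]
    refine hwD s hs s ?_
    rw [le_div_iff₀ (by positivity)]
    nlinarith [pow_pos hs 2, pow_pos hs 3, pow_pos hs 4]
  have hc : 0 < π * (n:ℝ) ^ 2 := by
    have : 0 < n := by omega
    positivity
  have hFw : ∀ ρ, F ρ = π * (n:ℝ) ^ 2 * stieltjes w 2 (ρ ^ 2) := fun ρ => by
    rw [hF ρ, stieltjes]
    simp only [hwdef, div_div, mul_comm]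
  set c := π * (n:ℝ) ^ 2
  set M := ∫ s in Ioi (0:ℝ), D s
  set m := stieltjes w 2 1
  have hm : 0 < m := stieltjes_pos hw hwi 2 one_pos
  refine ⟨20 * M ^ 2 / (c * m ^ 3), fun ρ hρ => ?_⟩
  have hx : 0 < ρ ^ 2 := pow_pos hρ 2
  rw [hκ, conformal_curvature_eq hc hw hwi hswi hFw hρ]
  set x := ρ ^ 2
  have hw0 : ∀ s, 0 < s → 0 ≤ w s := fun s hs => (hw s hs).le
  have u2 : stieltjes w 2 x ≤ M / (1 + x) ^ 2 := stieltjes_le hw0 hD (fun s hs => by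
    refine hwD s hs _ ?_
    rw [div_pow, div_le_div_iff₀ (by positivity) (by positivity)]
    have : s * 1 ≤ (1 + s) * (1 + s) := by gcongr <;> linarith
    calc (1 + s) ^ 2 * s ^ 3 = ((1 + s) ^ 2 * s ^ 2) * (s * 1) := by ring
      _ ≤ ((1 + s) ^ 2 * s ^ 2) * ((1 + s) * (1 + s)) := by gcongr
      _ = (1 + s) ^ 4 * s ^ 2 := by ring) hx
  have u3 : stieltjes w 3 x ≤ M / (1 + x) ^ 3 := stieltjes_le hw0 hD (fun s hs => by
    refine hwD s hs _ ?_
    rw [div_pow]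
    gcongr <;> linarith) hx
  have v3 : stieltjes (fun s => s * w s) 3 x ≤ M / (1 + x) ^ 3 :=
    stieltjes_le hsw hD (fun s hs => by
    rw [mul_comm s, mul_assoc]
    refine hwD s hs _ ?_
    rw [div_pow, mul_div_assoc']
    gcongr
    calc s * (1 + s) ^ 3 ≤ (1 + s) * (1 + s) ^ 3 := by gcongr; linarith
      _ = (1 + s) ^ 4 := by ring) hx
  have v4 : stieltjes (fun s => s * w s) 4 x ≤ M / (1 + x) ^ 4 :=
    stieltjes_le hsw hD (fun s hs => by
    rw [mul_comm s, mul_assoc]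
    refine hwD s hs _ (le_of_eq ?_)
    field_simp) hx
  have l2 : m / (1 + x) ^ 2 ≤ stieltjes w 2 x := stieltjes_one_div_le hw0 hwi 2 hx
  have p2 := stieltjes_nonneg hw0 2 hx
  have p3 := stieltjes_nonneg hw0 3 hx
  have q3 := stieltjes_nonneg hsw 3 hx
  have q4 := stieltjes_nonneg hsw 4 hx
  have hM : 0 ≤ M := by
    have := p2.trans u2
    rwa [le_div_iff₀ (by positivity), zero_mul] at this
  have a : stieltjes (fun s => s * w s) 4 x * stieltjes w 2 x ≤ M ^ 2 / (1 + x) ^ 6 :=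
    (mul_le_mul v4 u2 p2 (by positivity)).trans_eq (by field_simp)
  have b : stieltjes w 3 x * stieltjes (fun s => s * w s) 3 x ≤ M ^ 2 / (1 + x) ^ 6 :=
    (mul_le_mul u3 v3 q3 (by positivity)).trans_eq (by field_simp)
  have hnum : |4 * (3 * stieltjes (fun s => s * w s) 4 x * stieltjes w 2 x
      - 2 * stieltjes w 3 x * stieltjes (fun s => s * w s) 3 x)| ≤
      20 * (M ^ 2 / (1 + x) ^ 6) := by
    rw [abs_le]
    constructor <;> nlinarith [mul_nonneg q4 p2, mul_nonneg p3 q3]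
  have hden : 0 < c * (m / (1 + x) ^ 2) ^ 3 := by positivity
  have hden' : c * (m / (1 + x) ^ 2) ^ 3 ≤ c * stieltjes w 2 x ^ 3 := by gcongr
  rw [abs_div, abs_of_pos (hden.trans_le hden')]
  calc _ ≤ 20 * (M ^ 2 / (1 + x) ^ 6) / (c * (m / (1 + x) ^ 2) ^ 3) := by gcongr
    _ = 20 * M ^ 2 / (c * m ^ 3) := by field_simp
end
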